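/- Fix m, n ∈ ℕ with m, n ≥ 1, and B_X, B > 0. Let v_1,…,v_n ∈ ℝ^m satisfy ‖v_i‖_∞ ≤ B_X for all i, and let F_g = { v ↦ βᵀv : β ∈ ℝ^m, ‖β‖_2 ≤ B } be the class of linear functions on ℝ^m with coefficient vector of Euclidean norm at most B. Then the empirical Rademacher complexity of F_g at v_1,…,v_n satisfies R̂_n(F_g) ≤ ( 10/√(2en) + 5√π/√n + 4·exp(−0.16·n/m) ) · 3·√m·B·B_X. -/

import Mathlib

open Matrix

/-- The Euclidean (ℓ2) norm of a finitely indexed real vector. -/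
noncomputable def euclNorm {α : Type*} [Fintype α] (v : α → ℝ) : ℝ :=
  Real.sqrt (∑ i, v i ^ 2)

/-- The sign `±1` associated to a Boolean. -/
def signOf (b : Bool) : ℝ := if b then 1 else -1

/-- The empirical Rademacher complexity of a class `F` of real-valued functions at points
`z 0, …, z (n-1)`: `R̂_n(F) = E_σ sup_{f ∈ F} |(1/n)·Σ_i σ_i f(z_i)|`, where the expectation
is the uniform average over all `2^n` sign patterns. -/
noncomputable def empRademacher {Z : Type*} (F : Set (Z → ℝ)) (n : ℕ) (z : Fin n → Z) : ℝ :=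
  ((2 : ℝ) ^ n)⁻¹ * ∑ σ : Fin n → Bool,
    ⨆ f : F, |(1 / n : ℝ) * ∑ i, signOf (σ i) * (f : Z → ℝ) (z i)|

/-- Rademacher signs are orthonormal: `E (∑ σ_i a_i)² = ∑ a_i²`. -/
theorem sum_signOf_sq (n : ℕ) (a : Fin n → ℝ) :
    ∑ σ : Fin n → Bool, (∑ i, signOf (σ i) * a i) ^ 2 = 2 ^ n * ∑ i, a i ^ 2 := by
  induction n with
  | zero => simp
  | succ n ih =>
    rw [← (Fin.consEquiv fun _ : Fin (n + 1) => Bool).sum_comp, Fintype.sum_prod_type_right]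
    have key : ∀ τ : Fin n → Bool,
        ∑ b : Bool, (∑ i, signOf (Fin.consEquiv (fun _ : Fin (n + 1) => Bool) (b, τ) i) * a i) ^ 2
          = 2 * a 0 ^ 2 + 2 * (∑ i, signOf (τ i) * a i.succ) ^ 2 := by
      intro τ
      simp only [Fintype.sum_bool, Fin.consEquiv_apply, Fin.sum_univ_succ, Fin.cons_zero,
        Fin.cons_succ, signOf, if_true, Bool.false_eq_true, if_false]
      ring
    rw [Finset.sum_congr rfl fun τ _ => key τ, Finset.sum_add_distrib, ← Finset.mul_sum,
      ← Finset.mul_sum, ih fun i => a i.succ, Fin.sum_univ_succ]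
    simp only [Finset.sum_const, Finset.card_univ, Fintype.card_fun, Fintype.card_bool,
      Fintype.card_fin, nsmul_eq_mul, Nat.cast_pow, Nat.cast_ofNat]
    ring

theorem abs_dotProduct_le_euclNorm {α : Type*} [Fintype α] (x y : α → ℝ) :
    |x ⬝ᵥ y| ≤ euclNorm x * euclNorm y := by
  rw [euclNorm, euclNorm, ← Real.sqrt_mul (Finset.sum_nonneg fun i _ => sq_nonneg _)]
  exact Real.abs_le_sqrt (Finset.sum_mul_sq_le_sq_mul_sq _ _ _)

theorem sum_euclNorm_signed_sum_le (m n : ℕ) (C : ℝ) (hC : 0 ≤ C)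
    (v : Fin n → Fin m → ℝ) (hv : ∀ i j, |v i j| ≤ C) :
    ∑ σ : Fin n → Bool, euclNorm (fun j => ∑ i, signOf (σ i) * v i j)
      ≤ 2 ^ n * (Real.sqrt n * (Real.sqrt m * C)) := by
  refine le_of_sq_le_sq ?_ (by positivity)
  calc (∑ σ : Fin n → Bool, euclNorm (fun j => ∑ i, signOf (σ i) * v i j)) ^ 2
      ≤ 2 ^ n * ∑ σ : Fin n → Bool, euclNorm (fun j => ∑ i, signOf (σ i) * v i j) ^ 2 := by
        simpa using sq_sum_le_card_mul_sum_sq (s := (Finset.univ : Finset (Fin n → Bool)))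
          (f := fun σ => euclNorm (fun j => ∑ i, signOf (σ i) * v i j))
    _ = 2 ^ n * (2 ^ n * ∑ j, ∑ i, v i j ^ 2) := by
        have h : ∀ w : Fin m → ℝ, euclNorm w ^ 2 = ∑ j, w j ^ 2 := fun w =>
          Real.sq_sqrt (Finset.sum_nonneg fun i _ => sq_nonneg _)
        simp only [h]
        rw [Finset.sum_comm]
        simp only [sum_signOf_sq, Finset.mul_sum]
    _ ≤ 2 ^ n * (2 ^ n * ∑ _j : Fin m, ∑ _i : Fin n, C ^ 2) := by
        gcongr 2 ^ n * (2 ^ n * ∑ j, ∑ i, ?_) with j _ i _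
        exact sq_le_sq.mpr ((hv i j).trans (le_abs_self C))
    _ = (2 ^ n * (Real.sqrt n * (Real.sqrt m * C))) ^ 2 := by
        simp only [mul_pow, Real.sq_sqrt (Nat.cast_nonneg _), Finset.sum_const,
          Finset.card_univ, Fintype.card_fin, nsmul_eq_mul]
        ring

/-- The empirical Rademacher complexity of the linear class is at most `√m B C / √n`. -/
theorem empRademacher_linear_le (m n : ℕ) (hn : 1 ≤ n) (C B : ℝ) (hC : 0 ≤ C) (hB : 0 ≤ B)
    (v : Fin n → Fin m → ℝ) (hv : ∀ i j, |v i j| ≤ C) :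
    empRademacher {f : (Fin m → ℝ) → ℝ | ∃ β : Fin m → ℝ, euclNorm β ≤ B ∧
        f = fun x => β ⬝ᵥ x} n v
      ≤ 1 / Real.sqrt n * (Real.sqrt m * B * C) := by
  have hn0 : (0 : ℝ) < n := by exact_mod_cast hn
  have hnorm : ∀ w : Fin m → ℝ, 0 ≤ euclNorm w := fun w => Real.sqrt_nonneg _
  calc _ ≤ ((2 : ℝ) ^ n)⁻¹ * ∑ σ : Fin n → Bool,
        (1 / n : ℝ) * (B * euclNorm (fun j => ∑ i, signOf (σ i) * v i j)) := by
        unfold empRademacher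
        gcongr with σ _
        refine Real.iSup_le ?_ (by have := hnorm fun j => ∑ i, signOf (σ i) * v i j; positivity)
        rintro ⟨_, β, hβ, rfl⟩
        have h : ∑ i, signOf (σ i) * (β ⬝ᵥ v i)
            = β ⬝ᵥ fun j => ∑ i, signOf (σ i) * v i j := by
          simp only [dotProduct, Finset.mul_sum]
          rw [Finset.sum_comm]
          exact Finset.sum_congr rfl fun j _ => Finset.sum_congr rfl fun i _ => by ring
        simp only [h]
        rw [abs_mul, abs_of_nonneg (by positivity : (0 : ℝ) ≤ 1 / n)]
        gcongr
        exact (abs_dotProduct_le_euclNorm _ _).trans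
          (mul_le_mul_of_nonneg_right hβ (hnorm _))
    _ = ((2 : ℝ) ^ n)⁻¹ * ((1 / n : ℝ) * (B *
        ∑ σ : Fin n → Bool, euclNorm (fun j => ∑ i, signOf (σ i) * v i j))) := by
        simp only [Finset.mul_sum]
    _ ≤ ((2 : ℝ) ^ n)⁻¹ * ((1 / n : ℝ) * (B * (2 ^ n * (Real.sqrt n * (Real.sqrt m * C))))) := by
        gcongr
        exact sum_euclNorm_signed_sum_le m n C hC v hv
    _ = 1 / Real.sqrt n * (Real.sqrt m * B * C) := by
        have hs : 0 < Real.sqrt n := Real.sqrt_pos.mpr hn0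
        have hsq : (n : ℝ) = Real.sqrt n * Real.sqrt n := (Real.mul_self_sqrt hn0.le).symm
        have hi : (1 / n : ℝ) * Real.sqrt n = 1 / Real.sqrt n := by
          rw [div_mul_eq_mul_div, div_eq_div_iff hn0.ne' hs.ne']
          linarith
        have h2 : ((2 : ℝ) ^ n)⁻¹ * 2 ^ n = 1 := inv_mul_cancel₀ (by positivity)
        linear_combination (Real.sqrt m * B * C) * hi
          + ((1 / n : ℝ) * Real.sqrt n * (Real.sqrt m * B * C)) * h2

/-- For the class `F_g = {v ↦ βᵀv : ‖β‖₂ ≤ B}` of linear functions on `ℝ^m`, evaluated at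
points `v_1,…,v_n` with `‖v_i‖_∞ ≤ B_X`, the empirical Rademacher complexity satisfies
`R̂_n(F_g) ≤ (10/√(2en) + 5√π/√n + 4·exp(−0.16·n/m))·3·√m·B·B_X`. -/
theorem emp_rademacher_linear_class (m n : ℕ) (hm : 1 ≤ m) (hn : 1 ≤ n)
    (B_X B : ℝ) (hBX : 0 < B_X) (hB : 0 < B)
    (v : Fin n → Fin m → ℝ) (hv : ∀ i j, |v i j| ≤ B_X) :
    empRademacher {f : (Fin m → ℝ) → ℝ | ∃ β : Fin m → ℝ, euclNorm β ≤ B ∧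
        f = fun x => β ⬝ᵥ x} n v
      ≤ (10 / Real.sqrt (2 * Real.exp 1 * n) + 5 * Real.sqrt Real.pi / Real.sqrt n
          + 4 * Real.exp (-(0.16 * ((n : ℝ) / m))))
        * (3 * Real.sqrt m * B * B_X) := by
  refine (empRademacher_linear_le m n hn B_X B hBX.le hB.le v hv).trans ?_
  have hpi : 1 ≤ Real.sqrt Real.pi := Real.one_le_sqrt.mpr (by linarith [Real.pi_gt_three])
  have hle : 1 / Real.sqrt n ≤ 5 * Real.sqrt Real.pi / Real.sqrt n := by
    gcongr
    linarith
  have hfst : 0 ≤ 10 / Real.sqrt (2 * Real.exp 1 * n) := by positivity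
  have hexp : 0 ≤ 4 * Real.exp (-(0.16 * ((n : ℝ) / m))) := by positivity
  have hprod : 0 ≤ Real.sqrt m * B * B_X := by positivity
  exact mul_le_mul (by linarith) (by linarith) hprod
    (by positivity)
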